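/- Let α>1 and 0<β<∞, let u be holomorphic on 𝔻 and φ a holomorphic self-map of 𝔻. Then uC_φ : B^α → Z_β is compact if and only if uC_φ maps B^α boundedly into Z_β, lim_{n→∞} (n+1)^α ‖(2u'φ' + uφ'')·φ^n‖_{ν_β} = 0, lim_{n→∞} (n+1)^{α+1} ‖u·(φ')²·φ^n‖_{ν_β} = 0, and lim_{n→∞} (n+1)^{α-1} ‖u''·φ^n‖_{ν_β} = 0. -/

import Mathlib

open Complex Filter Set

noncomputable section

/-- The open unit disk in `ℂ`. -/
def unitDisk : Set ℂ := Metric.ball 0 1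

/-- The weighted sup-norm `‖g‖_{ν_γ} = sup_{z ∈ 𝔻} (1-|z|²)^γ |g(z)|`. -/
def wnorm (γ : ℝ) (g : ℂ → ℂ) : ℝ :=
  sSup ((fun z => (1 - ‖z‖ ^ 2) ^ γ * ‖g z‖) '' unitDisk)

/-- Membership in the weighted Banach space `H^∞_{ν_β}`. -/
def MemWeighted (β : ℝ) (g : ℂ → ℂ) : Prop :=
  DifferentiableOn ℂ g unitDisk ∧
    BddAbove ((fun z => (1 - ‖z‖ ^ 2) ^ β * ‖g z‖) '' unitDisk)

/-- Membership in the Bloch type space `B^α`. -/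
def MemBloch (α : ℝ) (f : ℂ → ℂ) : Prop :=
  DifferentiableOn ℂ f unitDisk ∧
    BddAbove ((fun z => (1 - ‖z‖ ^ 2) ^ α * ‖deriv f z‖) '' unitDisk)

/-- The Bloch type norm `‖f‖_{B^α} = |f(0)| + sup_{z∈𝔻}(1-|z|²)^α |f'(z)|`. -/
def blochNorm (α : ℝ) (f : ℂ → ℂ) : ℝ :=
  ‖f 0‖ + wnorm α (deriv f)

/-- Membership in the Zygmund type space `Z_β`. -/
def MemZygmund (β : ℝ) (f : ℂ → ℂ) : Prop :=
  DifferentiableOn ℂ f unitDisk ∧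
    BddAbove ((fun z => (1 - ‖z‖ ^ 2) ^ β * ‖deriv (deriv f) z‖) '' unitDisk)

/-- The Zygmund type norm `‖f‖_{Z_β} = |f(0)| + |f'(0)| + sup_{z∈𝔻}(1-|z|²)^β |f''(z)|`. -/
def zygNorm (β : ℝ) (f : ℂ → ℂ) : ℝ :=
  ‖f 0‖ + ‖deriv f 0‖ + wnorm β (deriv (deriv f))

/-- The weighted composition operator `uC_φ f = u · (f ∘ φ)`. -/
def wcomp (u φ f : ℂ → ℂ) : ℂ → ℂ := fun z => u z * f (φ z)

/-- `uC_φ` maps `B^α` boundedly into `Z_β`. -/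
def BoundedBlochToZygmund (α β : ℝ) (u φ : ℂ → ℂ) : Prop :=
  (∀ f, MemBloch α f → MemZygmund β (wcomp u φ f)) ∧
    ∃ C > 0, ∀ f, MemBloch α f → zygNorm β (wcomp u φ f) ≤ C * blochNorm α f

/-- `uC_φ` maps `B^α` boundedly into `H^∞_{ν_β}`. -/
def BoundedBlochToWeighted (α β : ℝ) (u φ : ℂ → ℂ) : Prop :=
  (∀ f, MemBloch α f → MemWeighted β (wcomp u φ f)) ∧
    ∃ C > 0, ∀ f, MemBloch α f → wnorm β (wcomp u φ f) ≤ C * blochNorm α f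

/-- `uC_φ : B^α → Z_β` is compact: it is bounded and maps bounded sets of `B^α` to
totally bounded (equivalently, since `Z_β` is complete, relatively compact) subsets
of `Z_β`. -/
def CompactBlochToZygmund (α β : ℝ) (u φ : ℂ → ℂ) : Prop :=
  BoundedBlochToZygmund α β u φ ∧
    ∀ r : ℝ, ∀ ε : ℝ, 0 < ε → ∃ T : Finset (ℂ → ℂ),
      (∀ g ∈ T, MemZygmund β g) ∧
      ∀ f, MemBloch α f → blochNorm α f ≤ r →
        ∃ g ∈ T, zygNorm β (fun z => wcomp u φ f z - g z) ≤ ε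

/-- `uC_φ : B^α → H^∞_{ν_β}` is compact: it is bounded and maps bounded sets of `B^α`
to totally bounded (equivalently, relatively compact) subsets of `H^∞_{ν_β}`. -/
def CompactBlochToWeighted (α β : ℝ) (u φ : ℂ → ℂ) : Prop :=
  BoundedBlochToWeighted α β u φ ∧
    ∀ r : ℝ, ∀ ε : ℝ, 0 < ε → ∃ T : Finset (ℂ → ℂ),
      (∀ g ∈ T, MemWeighted β g) ∧
      ∀ f, MemBloch α f → blochNorm α f ≤ r →
        ∃ g ∈ T, wnorm β (fun z => wcomp u φ f z - g z) ≤ ε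

/-- A compact (linear, bounded, with totally bounded image of the unit ball) operator
from the subspace of `B^α` cut out by the predicate `P` into `Z_β`. -/
def IsCompactOpToZygmund (α β : ℝ) (P : (ℂ → ℂ) → Prop) (K : (ℂ → ℂ) → ℂ → ℂ) : Prop :=
  (∀ f g, P f → P g → ∀ a b : ℂ,
      K (fun z => a * f z + b * g z) = fun z => a * K f z + b * K g z) ∧
  (∀ f, P f → MemZygmund β (K f)) ∧
  (∃ C, ∀ f, P f → zygNorm β (K f) ≤ C * blochNorm α f) ∧
  (∀ ε : ℝ, 0 < ε → ∃ T : Finset (ℂ → ℂ), (∀ g ∈ T, MemZygmund β g) ∧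
      ∀ f, P f → blochNorm α f ≤ 1 → ∃ g ∈ T, zygNorm β (fun z => K f z - g z) ≤ ε)

/-- The essential norm of `uC_φ`, as an operator from the subspace of `B^α` cut out by
the predicate `P` into `Z_β`: the distance to the compact operators, the operator norm
being the supremum over the unit ball. -/
def essNormZ (α β : ℝ) (P : (ℂ → ℂ) → Prop) (u φ : ℂ → ℂ) : ℝ :=
  sInf {r | ∃ K, IsCompactOpToZygmund α β P K ∧
    r = sSup {s | ∃ f, P f ∧ blochNorm α f ≤ 1 ∧
          s = zygNorm β (fun z => wcomp u φ f z - K f z)}}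

/-- A compact (linear, bounded, with totally bounded image of the unit ball) operator
from `B^α` into `H^∞_{ν_β}`. -/
def IsCompactOpToWeighted (α β : ℝ) (K : (ℂ → ℂ) → ℂ → ℂ) : Prop :=
  (∀ f g, MemBloch α f → MemBloch α g → ∀ a b : ℂ,
      K (fun z => a * f z + b * g z) = fun z => a * K f z + b * K g z) ∧
  (∀ f, MemBloch α f → MemWeighted β (K f)) ∧
  (∃ C, ∀ f, MemBloch α f → wnorm β (K f) ≤ C * blochNorm α f) ∧
  (∀ ε : ℝ, 0 < ε → ∃ T : Finset (ℂ → ℂ), (∀ g ∈ T, MemWeighted β g) ∧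
      ∀ f, MemBloch α f → blochNorm α f ≤ 1 → ∃ g ∈ T, wnorm β (fun z => K f z - g z) ≤ ε)

/-- The essential norm of `uC_φ : B^α → H^∞_{ν_β}`. -/
def essNormW (α β : ℝ) (u φ : ℂ → ℂ) : ℝ :=
  sInf {r | ∃ K, IsCompactOpToWeighted α β K ∧
    r = sSup {s | ∃ f, MemBloch α f ∧ blochNorm α f ≤ 1 ∧
          s = wnorm β (fun z => wcomp u φ f z - K f z)}}

/-- `limsup_{|φ(z)|→1} F(z) = lim_{s→1⁻} sup {F z : z ∈ 𝔻, |φ z| > s}`.  Since the inner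
supremum is nonincreasing in `s`, the limit equals the infimum over `s ∈ [0,1)`; note
that `Real.sSup ∅ = 0`, matching the convention that the value is `0` when
`{z : |φ z| > s}` is empty for some `s < 1`. -/
def phiLimsup (φ : ℂ → ℂ) (F : ℂ → ℝ) : ℝ :=
  sInf ((fun s => sSup {y | ∃ z ∈ unitDisk, s < ‖φ z‖ ∧ y = F z}) '' Set.Ico (0:ℝ) 1)

lemma isOpen_unitDisk : IsOpen unitDisk := Metric.isOpen_ball

lemma mem_unitDisk_iff {z : ℂ} : z ∈ unitDisk ↔ ‖z‖ < 1 := by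
  simp [unitDisk]

lemma zero_mem_unitDisk : (0 : ℂ) ∈ unitDisk := by
  simp [unitDisk]

lemma one_sub_sq_pos {z : ℂ} (hz : z ∈ unitDisk) : 0 < 1 - ‖z‖ ^ 2 := by
  have := mem_unitDisk_iff.1 hz
  nlinarith [norm_nonneg z]

lemma weight_nonneg (γ : ℝ) {z : ℂ} (hz : z ∈ unitDisk) : 0 ≤ (1 - ‖z‖ ^ 2) ^ γ :=
  Real.rpow_nonneg (one_sub_sq_pos hz).le _

/-- Boundedness of the weighted modulus of `g` on the disk. -/
def WBdd (γ : ℝ) (g : ℂ → ℂ) : Prop :=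
  BddAbove ((fun z => (1 - ‖z‖ ^ 2) ^ γ * ‖g z‖) '' unitDisk)

lemma wBdd_of_le {γ : ℝ} {g : ℂ → ℂ} (C : ℝ)
    (h : ∀ z ∈ unitDisk, (1 - ‖z‖ ^ 2) ^ γ * ‖g z‖ ≤ C) : WBdd γ g := by
  refine ⟨C, ?_⟩
  rintro _ ⟨z, hz, rfl⟩
  exact h z hz

lemma wnorm_le {γ : ℝ} {g : ℂ → ℂ} {C : ℝ}
    (h : ∀ z ∈ unitDisk, (1 - ‖z‖ ^ 2) ^ γ * ‖g z‖ ≤ C) : wnorm γ g ≤ C := by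
  refine csSup_le ⟨_, ⟨0, zero_mem_unitDisk, rfl⟩⟩ ?_
  rintro _ ⟨z, hz, rfl⟩
  exact h z hz

lemma WBdd.le_wnorm {γ : ℝ} {g : ℂ → ℂ} (h : WBdd γ g) {z : ℂ} (hz : z ∈ unitDisk) :
    (1 - ‖z‖ ^ 2) ^ γ * ‖g z‖ ≤ wnorm γ g :=
  le_csSup h ⟨z, hz, rfl⟩

lemma wnorm_nonneg (γ : ℝ) (g : ℂ → ℂ) : 0 ≤ wnorm γ g := by
  apply Real.sSup_nonneg
  rintro _ ⟨z, hz, rfl⟩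
  exact mul_nonneg (weight_nonneg γ hz) (norm_nonneg _)

lemma weighted_norm_add_le {γ : ℝ} {z : ℂ} (hz : z ∈ unitDisk) (a b : ℂ) :
    (1 - ‖z‖ ^ 2) ^ γ * ‖a + b‖ ≤ (1 - ‖z‖ ^ 2) ^ γ * ‖a‖ + (1 - ‖z‖ ^ 2) ^ γ * ‖b‖ := by
  rw [← mul_add]
  exact mul_le_mul_of_nonneg_left (norm_add_le a b) (weight_nonneg γ hz)

lemma weighted_norm_sub_le {γ : ℝ} {z : ℂ} (hz : z ∈ unitDisk) (a b : ℂ) :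
    (1 - ‖z‖ ^ 2) ^ γ * ‖a - b‖ ≤ (1 - ‖z‖ ^ 2) ^ γ * ‖a‖ + (1 - ‖z‖ ^ 2) ^ γ * ‖b‖ := by
  rw [← mul_add]
  exact mul_le_mul_of_nonneg_left (norm_sub_le a b) (weight_nonneg γ hz)

lemma WBdd.mono {γ : ℝ} {g h : ℂ → ℂ} (hh : WBdd γ h)
    (hle : ∀ z ∈ unitDisk, ‖g z‖ ≤ ‖h z‖) : WBdd γ g :=
  wBdd_of_le (wnorm γ h) fun z hz =>
    (mul_le_mul_of_nonneg_left (hle z hz) (weight_nonneg γ hz)).trans (hh.le_wnorm hz)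

lemma WBdd.wnorm_mono {γ : ℝ} {g h : ℂ → ℂ} (hh : WBdd γ h)
    (hle : ∀ z ∈ unitDisk, ‖g z‖ ≤ ‖h z‖) : wnorm γ g ≤ wnorm γ h :=
  wnorm_le fun z hz =>
    (mul_le_mul_of_nonneg_left (hle z hz) (weight_nonneg γ hz)).trans (hh.le_wnorm hz)

lemma WBdd.add {γ : ℝ} {g h : ℂ → ℂ} (hg : WBdd γ g) (hh : WBdd γ h) :
    WBdd γ (fun z => g z + h z) :=
  wBdd_of_le (wnorm γ g + wnorm γ h) fun _ hz =>
    (weighted_norm_add_le hz _ _).trans (add_le_add (hg.le_wnorm hz) (hh.le_wnorm hz))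

lemma WBdd.sub {γ : ℝ} {g h : ℂ → ℂ} (hg : WBdd γ g) (hh : WBdd γ h) :
    WBdd γ (fun z => g z - h z) :=
  wBdd_of_le (wnorm γ g + wnorm γ h) fun _ hz =>
    (weighted_norm_sub_le hz _ _).trans (add_le_add (hg.le_wnorm hz) (hh.le_wnorm hz))

lemma WBdd.const_mul {γ : ℝ} {g : ℂ → ℂ} (hg : WBdd γ g) (c : ℂ) :
    WBdd γ (fun z => c * g z) :=
  wBdd_of_le (‖c‖ * wnorm γ g) fun z hz => by
    rw [norm_mul, mul_left_comm]
    exact mul_le_mul_of_nonneg_left (hg.le_wnorm hz) (norm_nonneg c)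

lemma WBdd.mul_of_norm_le_one {γ : ℝ} {g p : ℂ → ℂ} (hg : WBdd γ g)
    (hp : ∀ z ∈ unitDisk, ‖p z‖ ≤ 1) : WBdd γ (fun z => g z * p z) :=
  hg.mono fun z hz => by
    rw [norm_mul]
    exact mul_le_of_le_one_right (norm_nonneg _) (hp z hz)

lemma norm_lt_one_of_mapsTo {φ : ℂ → ℂ} (hφm : MapsTo φ unitDisk unitDisk) {z : ℂ}
    (hz : z ∈ unitDisk) : ‖φ z‖ < 1 :=
  mem_unitDisk_iff.1 (hφm hz)

lemma WBdd.mul_pow {γ : ℝ} {g φ : ℂ → ℂ} (hφm : MapsTo φ unitDisk unitDisk)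
    (hg : WBdd γ g) (n : ℕ) : WBdd γ (fun z => g z * φ z ^ n) :=
  hg.mul_of_norm_le_one fun z hz => by
    rw [norm_pow]
    exact pow_le_one₀ (norm_nonneg _) (norm_lt_one_of_mapsTo hφm hz).le

lemma WBdd.antitone_wnorm_mul_pow {γ : ℝ} {g φ : ℂ → ℂ} (hφm : MapsTo φ unitDisk unitDisk)
    (hg : WBdd γ g) : Antitone fun n : ℕ => wnorm γ (fun z => g z * φ z ^ n) :=
  fun m n hmn => (hg.mul_pow hφm m).wnorm_mono fun z hz => by
    simp only [norm_mul, norm_pow]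
    exact mul_le_mul_of_nonneg_left
      (pow_le_pow_of_le_one (norm_nonneg _) (norm_lt_one_of_mapsTo hφm hz).le hmn) (norm_nonneg _)

lemma deriv_congr_of_eqOn_unitDisk {f g : ℂ → ℂ} (h : EqOn f g unitDisk) :
    EqOn (deriv f) (deriv g) unitDisk := fun _ hz =>
  (h.eventuallyEq_of_mem (isOpen_unitDisk.mem_nhds hz)).deriv_eq

lemma differentiableOn_deriv {f : ℂ → ℂ} (hf : DifferentiableOn ℂ f unitDisk) :
    DifferentiableOn ℂ (deriv f) unitDisk :=
  hf.deriv isOpen_unitDisk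

lemma hasDerivAt_of_differentiableOn {f : ℂ → ℂ} (hf : DifferentiableOn ℂ f unitDisk) {z : ℂ}
    (hz : z ∈ unitDisk) : HasDerivAt f (deriv f z) z :=
  (hf.differentiableAt (isOpen_unitDisk.mem_nhds hz)).hasDerivAt

lemma deriv_sub_of_differentiableOn {f g : ℂ → ℂ} (hf : DifferentiableOn ℂ f unitDisk)
    (hg : DifferentiableOn ℂ g unitDisk) {z : ℂ} (hz : z ∈ unitDisk) :
    deriv (fun z => f z - g z) z = deriv f z - deriv g z :=
  ((hasDerivAt_of_differentiableOn hf hz).sub (hasDerivAt_of_differentiableOn hg hz)).deriv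

lemma deriv_deriv_sub_of_differentiableOn {f g : ℂ → ℂ} (hf : DifferentiableOn ℂ f unitDisk)
    (hg : DifferentiableOn ℂ g unitDisk) {z : ℂ} (hz : z ∈ unitDisk) :
    deriv (deriv (fun z => f z - g z)) z = deriv (deriv f) z - deriv (deriv g) z := by
  rw [deriv_congr_of_eqOn_unitDisk (fun _ hw => deriv_sub_of_differentiableOn hf hg hw) hz]
  exact deriv_sub_of_differentiableOn (differentiableOn_deriv hf) (differentiableOn_deriv hg) hz

section WeightedComposition

variable {u φ f : ℂ → ℂ}

lemma deriv_wcomp (hu : DifferentiableOn ℂ u unitDisk)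
    (hφd : DifferentiableOn ℂ φ unitDisk) (hφm : MapsTo φ unitDisk unitDisk)
    (hf : DifferentiableOn ℂ f unitDisk) {z : ℂ} (hz : z ∈ unitDisk) :
    deriv (wcomp u φ f) z = deriv u z * f (φ z) + u z * (deriv f (φ z) * deriv φ z) :=
  ((hasDerivAt_of_differentiableOn hu hz).mul
    ((hasDerivAt_of_differentiableOn hf (hφm hz)).comp z
      (hasDerivAt_of_differentiableOn hφd hz))).deriv

lemma deriv_deriv_wcomp (hu : DifferentiableOn ℂ u unitDisk)
    (hφd : DifferentiableOn ℂ φ unitDisk) (hφm : MapsTo φ unitDisk unitDisk)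
    (hf : DifferentiableOn ℂ f unitDisk) {z : ℂ} (hz : z ∈ unitDisk) :
    deriv (deriv (wcomp u φ f)) z = deriv (deriv u) z * f (φ z)
      + (2 * deriv u z * deriv φ z + u z * deriv (deriv φ) z) * deriv f (φ z)
      + u z * deriv φ z ^ 2 * deriv (deriv f) (φ z) := by
  rw [deriv_congr_of_eqOn_unitDisk (fun _ hw => deriv_wcomp hu hφd hφm hf hw) hz]
  have hu1 := hasDerivAt_of_differentiableOn hu hz
  have hu2 := hasDerivAt_of_differentiableOn (differentiableOn_deriv hu) hz
  have hφ1 := hasDerivAt_of_differentiableOn hφd hz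
  have hφ2 := hasDerivAt_of_differentiableOn (differentiableOn_deriv hφd) hz
  have hf1 := (hasDerivAt_of_differentiableOn hf (hφm hz)).comp z hφ1
  have hf2 := (hasDerivAt_of_differentiableOn (differentiableOn_deriv hf) (hφm hz)).comp z hφ1
  have h := (hu2.mul hf1).add (hu1.mul (hf2.mul hφ2))
  refine h.deriv.trans ?_
  simp only [Function.comp_apply, Pi.mul_apply]
  ring

end WeightedComposition

lemma MemBloch.sub {α : ℝ} {f g : ℂ → ℂ} (hf : MemBloch α f) (hg : MemBloch α g) :
    MemBloch α (fun z => f z - g z) := by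
  refine ⟨hf.1.sub hg.1, WBdd.mono (WBdd.sub hf.2 hg.2) fun z hz => ?_⟩
  rw [deriv_sub_of_differentiableOn hf.1 hg.1 hz]

lemma MemBloch.blochNorm_sub_le {α : ℝ} {f g : ℂ → ℂ} (hf : MemBloch α f) (hg : MemBloch α g) :
    blochNorm α (fun z => f z - g z) ≤ blochNorm α f + blochNorm α g := by
  have h1 := norm_sub_le (f 0) (g 0)
  have h2 : wnorm α (deriv fun z => f z - g z) ≤ wnorm α (deriv f) + wnorm α (deriv g) := by
    refine wnorm_le fun z hz => ?_
    rw [deriv_sub_of_differentiableOn hf.1 hg.1 hz]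
    exact (weighted_norm_sub_le hz _ _).trans
      (add_le_add (WBdd.le_wnorm hf.2 hz) (WBdd.le_wnorm hg.2 hz))
  unfold blochNorm
  linarith

lemma blochNorm_nonneg (α : ℝ) (f : ℂ → ℂ) : 0 ≤ blochNorm α f :=
  add_nonneg (norm_nonneg _) (wnorm_nonneg _ _)

lemma deriv_const_mul_pow (c : ℂ) (n : ℕ) :
    deriv (fun z : ℂ => c * z ^ n) = fun z => c * (n * z ^ (n - 1)) := by
  funext z
  simp

lemma deriv_deriv_const_mul_pow (c : ℂ) (n : ℕ) :
    deriv (deriv (fun z : ℂ => c * z ^ n)) =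
      fun z => c * (n * ((n - 1 : ℕ) * z ^ (n - 1 - 1))) := by
  rw [deriv_const_mul_pow]
  funext z
  simp

/-- The elementary bound behind `‖z ^ n‖_{B^α} = O(n ^ (1 - α))`. -/
lemma rpow_mul_pow_mul_rpow_le {α : ℝ} (hα : 0 < α) (k : ℕ) {x : ℝ} (hx0 : 0 ≤ x) (hx1 : x < 1) :
    ((k : ℝ) + 1) ^ α * (x ^ k * (1 - x ^ 2) ^ α) ≤ (2 * α) ^ α * Real.exp 1 := by
  have ht : 0 < 1 - x := by linarith
  have hk : (0 : ℝ) < (k : ℝ) + 1 := by positivity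
  set y : ℝ := ((k : ℝ) + 1) * (1 - x) with hy
  have hy0 : 0 ≤ y := by positivity
  have h1 : (1 - x ^ 2) ^ α ≤ (2 * (1 - x)) ^ α :=
    Real.rpow_le_rpow (by nlinarith) (by nlinarith) hα.le
  have h2 : y ^ α ≤ α ^ α * Real.exp y := by
    have h3 : y / α ≤ Real.exp (y / α) := by linarith [Real.add_one_le_exp (y / α)]
    have h4 := Real.rpow_le_rpow (by positivity) h3 hα.le
    rw [← Real.exp_mul, div_mul_cancel₀ _ hα.ne', Real.div_rpow hy0 hα.le,
      div_le_iff₀ (by positivity)] at h4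
    linarith
  have h5 : x ^ k ≤ Real.exp (-(k * (1 - x))) := by
    have h6 : x ≤ Real.exp (-(1 - x)) := by linarith [Real.add_one_le_exp (-(1 - x))]
    calc x ^ k ≤ Real.exp (-(1 - x)) ^ k := pow_le_pow_left₀ hx0 h6 k
      _ = Real.exp (-(k * (1 - x))) := by rw [← Real.exp_nat_mul]; congr 1; ring
  have h7 : Real.exp y * Real.exp (-(k * (1 - x))) ≤ Real.exp 1 := by
    rw [← Real.exp_add]
    apply Real.exp_le_exp.2
    rw [hy]; nlinarith
  calc ((k : ℝ) + 1) ^ α * (x ^ k * (1 - x ^ 2) ^ α)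
      ≤ ((k : ℝ) + 1) ^ α * (x ^ k * (2 * (1 - x)) ^ α) := by gcongr
    _ = 2 ^ α * (y ^ α * x ^ k) := by
        rw [hy, Real.mul_rpow (by norm_num) ht.le, Real.mul_rpow hk.le ht.le]; ring
    _ ≤ 2 ^ α * ((α ^ α * Real.exp y) * Real.exp (-(k * (1 - x)))) := by gcongr
    _ = 2 ^ α * α ^ α * (Real.exp y * Real.exp (-(k * (1 - x)))) := by ring
    _ ≤ 2 ^ α * α ^ α * Real.exp 1 := by gcongr
    _ = (2 * α) ^ α * Real.exp 1 := by rw [Real.mul_rpow (by norm_num) hα.le]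

/-- The normalised monomial `n ^ (α - 1) * z ^ n`. -/
def normMonomial (α : ℝ) (n : ℕ) : ℂ → ℂ := fun z => (((n : ℝ) ^ (α - 1) : ℝ) : ℂ) * z ^ n

lemma weighted_deriv_normMonomial_le {α : ℝ} (hα : 1 < α) (n : ℕ) {z : ℂ} (hz : z ∈ unitDisk) :
    (1 - ‖z‖ ^ 2) ^ α * ‖deriv (normMonomial α n) z‖ ≤ (2 * α) ^ α * Real.exp 1 := by
  have hα0 : 0 < α := by linarith
  unfold normMonomial
  rw [deriv_const_mul_pow]
  rcases n with _ | k
  · simp; positivity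
  · have hk : (0 : ℝ) < ((k + 1 : ℕ) : ℝ) := by positivity
    have h := rpow_mul_pow_mul_rpow_le hα0 k (norm_nonneg z) (mem_unitDisk_iff.1 hz)
    refine le_trans (le_of_eq ?_) h
    simp only [norm_mul, norm_pow, Complex.norm_real, Complex.norm_natCast, Nat.add_sub_cancel]
    rw [Real.norm_of_nonneg (by positivity), Real.rpow_sub_one hk.ne']
    field_simp
    push_cast
    ring

lemma memBloch_normMonomial {α : ℝ} (hα : 1 < α) (n : ℕ) : MemBloch α (normMonomial α n) :=
  ⟨by unfold normMonomial; fun_prop,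
    wBdd_of_le _ fun _ hz => weighted_deriv_normMonomial_le hα n hz⟩

lemma blochNorm_normMonomial_le {α : ℝ} (hα : 1 < α) (n : ℕ) :
    blochNorm α (normMonomial α n) ≤ 1 + (2 * α) ^ α * Real.exp 1 := by
  refine add_le_add ?_ (wnorm_le fun _ hz => weighted_deriv_normMonomial_le hα n hz)
  have : α - 1 ≠ 0 := by linarith
  rcases n with _ | k <;> simp [normMonomial, Real.zero_rpow this]

lemma memBloch_pow {α : ℝ} (hα : 1 < α) (n : ℕ) : MemBloch α (fun z => z ^ n) := by
  have hα0 : 0 < α := by linarith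
  refine ⟨by fun_prop, wBdd_of_le n fun z hz => ?_⟩
  have h1 : (1 - ‖z‖ ^ 2) ^ α ≤ 1 :=
    Real.rpow_le_one (one_sub_sq_pos hz).le (by nlinarith [norm_nonneg z]) hα0.le
  have h2 : ‖deriv (fun z : ℂ => z ^ n) z‖ ≤ n := by
    simp only [deriv_pow_field, norm_mul, norm_pow, Complex.norm_natCast]
    exact mul_le_of_le_one_right (by positivity)
      (pow_le_one₀ (norm_nonneg _) (mem_unitDisk_iff.1 hz).le)
  calc _ ≤ 1 * (n : ℝ) := mul_le_mul h1 h2 (norm_nonneg _) zero_le_one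
    _ = n := one_mul _

/-- The coefficient of `f' ∘ φ` in `(u · f ∘ φ)''`. -/
def coeffOne (u φ : ℂ → ℂ) : ℂ → ℂ :=
  fun z => 2 * deriv u z * deriv φ z + u z * deriv (deriv φ) z

/-- The coefficient of `f'' ∘ φ` in `(u · f ∘ φ)''`. -/
def coeffTwo (u φ : ℂ → ℂ) : ℂ → ℂ := fun z => u z * deriv φ z ^ 2

/-- The second derivative of `u · φ ^ n`. -/
def powImage (u φ : ℂ → ℂ) (n : ℕ) : ℂ → ℂ := deriv (deriv (wcomp u φ fun w => w ^ n))

lemma mul_wnorm_le {γ c C : ℝ} {g : ℂ → ℂ} (hc : 0 ≤ c)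
    (h : ∀ z ∈ unitDisk, c * ((1 - ‖z‖ ^ 2) ^ γ * ‖g z‖) ≤ C) : c * wnorm γ g ≤ C := by
  rcases hc.eq_or_lt with rfl | hc
  · simpa using h 0 zero_mem_unitDisk
  · rw [← le_div_iff₀' hc]
    exact wnorm_le fun z hz => by
      rw [le_div_iff₀' hc]
      exact h z hz

lemma tendsto_rpow_mul_of_antitone {γ : ℝ} (hγ : 0 ≤ γ) {G : ℕ → ℝ} (hG : Antitone G)
    (hG0 : ∀ n, 0 ≤ G n) (h : Tendsto (fun n : ℕ => (n : ℝ) ^ γ * G (3 * n)) atTop (nhds 0)) :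
    Tendsto (fun n : ℕ => ((n : ℝ) + 1) ^ γ * G n) atTop (nhds 0) := by
  have h3 : Tendsto (fun n : ℕ => n / 3) atTop atTop := Nat.tendsto_div_const_atTop (by norm_num)
  have h6 := (h.comp h3).const_mul ((6 : ℝ) ^ γ)
  rw [mul_zero] at h6
  refine squeeze_zero' (Eventually.of_forall fun n => mul_nonneg (by positivity) (hG0 n)) ?_ h6
  filter_upwards [eventually_ge_atTop 3] with n hn
  have h1 : (n : ℝ) + 1 ≤ 6 * ((n / 3 : ℕ) : ℝ) := by
    have : n + 1 ≤ 6 * (n / 3) := by omega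
    exact_mod_cast this
  have h2 : ((n : ℝ) + 1) ^ γ ≤ 6 ^ γ * ((n / 3 : ℕ) : ℝ) ^ γ := by
    rw [← Real.mul_rpow (by norm_num) (by positivity)]
    exact Real.rpow_le_rpow (by positivity) h1 hγ
  calc ((n : ℝ) + 1) ^ γ * G n ≤ (6 ^ γ * ((n / 3 : ℕ) : ℝ) ^ γ) * G (3 * (n / 3)) :=
        mul_le_mul h2 (hG (by omega)) (hG0 _) (by positivity)
    _ = _ := by simp [mul_assoc]

lemma tendsto_rpow_mul_pow {γ b : ℝ} (hb0 : 0 < b) (hb1 : b < 1) :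
    Tendsto (fun n : ℕ => (n : ℝ) ^ γ * b ^ n) atTop (nhds 0) := by
  have h := (tendsto_rpow_mul_exp_neg_mul_atTop_nhds_zero γ (-Real.log b)
    (by linarith [Real.log_neg hb0 hb1])).comp tendsto_natCast_atTop_atTop
  refine h.congr fun n => ?_
  simp only [Function.comp_apply, neg_neg]
  rw [mul_comm (Real.log b), Real.exp_nat_mul, Real.exp_log hb0]

section Coefficients

variable {u φ : ℂ → ℂ} {α β : ℝ}

lemma powImage_apply (hu : DifferentiableOn ℂ u unitDisk)
    (hφd : DifferentiableOn ℂ φ unitDisk) (hφm : MapsTo φ unitDisk unitDisk) (n : ℕ)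
    {z : ℂ} (hz : z ∈ unitDisk) :
    powImage u φ n z = deriv (deriv u) z * φ z ^ n + coeffOne u φ z * (n * φ z ^ (n - 1))
      + coeffTwo u φ z * (n * ((n - 1 : ℕ) * φ z ^ (n - 1 - 1))) := by
  have h1 := deriv_const_mul_pow 1 n
  have h2 := deriv_deriv_const_mul_pow 1 n
  simp only [one_mul] at h1 h2
  rw [powImage, deriv_deriv_wcomp hu hφd hφm (by fun_prop) hz, h2, h1]
  rfl

lemma sq_mul_powImage (hu : DifferentiableOn ℂ u unitDisk)
    (hφd : DifferentiableOn ℂ φ unitDisk) (hφm : MapsTo φ unitDisk unitDisk) (n : ℕ)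
    {z : ℂ} (hz : z ∈ unitDisk) :
    φ z ^ 2 * powImage u φ n z = φ z ^ n * (deriv (deriv u) z * φ z ^ 2
      + n * coeffOne u φ z * φ z + n * (n - 1) * coeffTwo u φ z) := by
  rw [powImage_apply hu hφd hφm n hz]
  rcases n with _ | _ | n
  · simp; ring
  · simp; ring
  · simp only [Nat.add_sub_cancel]
    push_cast
    ring

lemma deriv_deriv_wcomp_normMonomial (n : ℕ) (z : ℂ) :
    deriv (deriv (wcomp u φ (normMonomial α n))) z =
      (((n : ℝ) ^ (α - 1) : ℝ) : ℂ) * powImage u φ n z := by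
  have h : wcomp u φ (normMonomial α n) =
      fun z => (((n : ℝ) ^ (α - 1) : ℝ) : ℂ) * wcomp u φ (fun w => w ^ n) z := by
    funext w
    simp only [wcomp, normMonomial]
    ring
  rw [h, powImage, deriv_const_mul_field', deriv_const_mul_field]

lemma wBdd_powImage (hα : 1 < α) (hb : BoundedBlochToZygmund α β u φ) (n : ℕ) :
    WBdd β (powImage u φ n) :=
  (hb.1 _ (memBloch_pow hα n)).2

lemma wBdd_deriv_deriv (hu : DifferentiableOn ℂ u unitDisk)
    (hφd : DifferentiableOn ℂ φ unitDisk) (hφm : MapsTo φ unitDisk unitDisk) (hα : 1 < α)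
    (hb : BoundedBlochToZygmund α β u φ) : WBdd β (deriv (deriv u)) :=
  (wBdd_powImage hα hb 0).mono fun z hz => by simp [powImage_apply hu hφd hφm 0 hz]

lemma wBdd_coeffOne (hu : DifferentiableOn ℂ u unitDisk)
    (hφd : DifferentiableOn ℂ φ unitDisk) (hφm : MapsTo φ unitDisk unitDisk) (hα : 1 < α)
    (hb : BoundedBlochToZygmund α β u φ) : WBdd β (coeffOne u φ) :=
  ((wBdd_powImage hα hb 1).sub
    ((wBdd_deriv_deriv hu hφd hφm hα hb).mul_pow hφm 1)).mono fun z hz => by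
      simp [powImage_apply hu hφd hφm 1 hz]

lemma wBdd_coeffTwo (hu : DifferentiableOn ℂ u unitDisk)
    (hφd : DifferentiableOn ℂ φ unitDisk) (hφm : MapsTo φ unitDisk unitDisk) (hα : 1 < α)
    (hb : BoundedBlochToZygmund α β u φ) : WBdd β (coeffTwo u φ) :=
  ((((wBdd_powImage hα hb 2).sub ((wBdd_deriv_deriv hu hφd hφm hα hb).mul_pow hφm 2)).sub
    (((wBdd_coeffOne hu hφd hφm hα hb).mul_pow hφm 1).const_mul 2)).const_mul 2⁻¹).mono
      fun z hz => le_of_eq <| by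
        rw [powImage_apply hu hφd hφm 2 hz]
        congr 1
        push_cast
        ring

lemma tendsto_weighted_powImage (hu : DifferentiableOn ℂ u unitDisk)
    (hφd : DifferentiableOn ℂ φ unitDisk) (hφm : MapsTo φ unitDisk unitDisk)
    {z : ℂ} (hz : z ∈ unitDisk) :
    Tendsto (fun n : ℕ => (n : ℝ) ^ (α - 1) * ‖powImage u φ n z‖) atTop (nhds 0) := by
  set b : ℝ := max ‖φ z‖ (1 / 2) with hb
  have hb0 : 0 < b := lt_max_of_lt_right (by norm_num)
  have hb1 : b < 1 := max_lt (norm_lt_one_of_mapsTo hφm hz) (by norm_num)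
  set M : ℝ := ‖deriv (deriv u) z‖ + ‖coeffOne u φ z‖ + ‖coeffTwo u φ z‖ with hM
  have hlim := (tendsto_rpow_mul_pow (γ := α - 1 + 2) hb0 hb1).const_mul (M / b ^ 2)
  rw [mul_zero] at hlim
  refine squeeze_zero' (Eventually.of_forall fun n => by positivity) ?_ hlim
  filter_upwards [eventually_ge_atTop 2] with n hn
  obtain ⟨k, rfl⟩ := Nat.exists_eq_add_of_le' hn
  have hn0 : (0 : ℝ) < ((k + 2 : ℕ) : ℝ) := by positivity
  have hφb : ‖φ z‖ ≤ b := le_max_left _ _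
  have hpow : ∀ j, ‖φ z‖ ^ (k + j) ≤ b ^ k := fun j =>
    (pow_le_pow_left₀ (norm_nonneg _) hφb _).trans
      (pow_le_pow_of_le_one hb0.le hb1.le (Nat.le_add_right _ _))
  have h1 : (1 : ℝ) ≤ ((k + 2 : ℕ) : ℝ) := by exact_mod_cast Nat.le_add_left 1 (k + 1)
  have hA : ‖deriv (deriv u) z * φ z ^ (k + 2)‖
      ≤ ‖deriv (deriv u) z‖ * (((k + 2 : ℕ) : ℝ) ^ 2 * b ^ k) := by
    rw [norm_mul, norm_pow]
    refine mul_le_mul_of_nonneg_left ?_ (norm_nonneg _)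
    exact (hpow 2).trans (le_mul_of_one_le_left (by positivity) (one_le_pow₀ h1))
  have hB : ‖coeffOne u φ z * (((k + 2 : ℕ) : ℂ) * φ z ^ (k + 1))‖
      ≤ ‖coeffOne u φ z‖ * (((k + 2 : ℕ) : ℝ) ^ 2 * b ^ k) := by
    rw [norm_mul, norm_mul, norm_pow, Complex.norm_natCast]
    refine mul_le_mul_of_nonneg_left ?_ (norm_nonneg _)
    exact mul_le_mul (by nlinarith) (hpow 1) (by positivity) (by positivity)
  have hD : ‖coeffTwo u φ z * (((k + 2 : ℕ) : ℂ) * (((k + 1 : ℕ) : ℂ) * φ z ^ k))‖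
      ≤ ‖coeffTwo u φ z‖ * (((k + 2 : ℕ) : ℝ) ^ 2 * b ^ k) := by
    rw [norm_mul, norm_mul, norm_mul, norm_pow, Complex.norm_natCast, Complex.norm_natCast]
    refine mul_le_mul_of_nonneg_left ?_ (norm_nonneg _)
    rw [← mul_assoc]
    refine mul_le_mul ?_ (hpow 0) (by positivity) (by positivity)
    push_cast
    nlinarith
  have hE : ‖powImage u φ (k + 2) z‖ ≤ M * (((k + 2 : ℕ) : ℝ) ^ 2 * b ^ k) := by
    rw [powImage_apply hu hφd hφm _ hz, hM, add_mul, add_mul]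
    exact norm_add₃_le.trans (add_le_add (add_le_add hA hB) hD)
  calc ((k + 2 : ℕ) : ℝ) ^ (α - 1) * ‖powImage u φ (k + 2) z‖
      ≤ ((k + 2 : ℕ) : ℝ) ^ (α - 1) * (M * (((k + 2 : ℕ) : ℝ) ^ 2 * b ^ k)) := by gcongr
    _ = M / b ^ 2 * (((k + 2 : ℕ) : ℝ) ^ (α - 1 + 2) * b ^ (k + 2)) := by
      rw [Real.rpow_add hn0, Real.rpow_two, pow_add b]
      field_simp

/-- The weighted norms of the second derivatives of the images of the normalised monomials. -/
def monomialImageNorm (α β : ℝ) (u φ : ℂ → ℂ) (n : ℕ) : ℝ :=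
  wnorm β (deriv (deriv (wcomp u φ (normMonomial α n))))

lemma tendsto_monomialImageNorm (hu : DifferentiableOn ℂ u unitDisk)
    (hφd : DifferentiableOn ℂ φ unitDisk) (hφm : MapsTo φ unitDisk unitDisk) (hα : 1 < α)
    (hc : CompactBlochToZygmund α β u φ) :
    Tendsto (monomialImageNorm α β u φ) atTop (nhds 0) := by
  obtain ⟨hb, hcpt⟩ := hc
  have key : ∀ ε : ℝ, 0 < ε → ∀ᶠ n in atTop, monomialImageNorm α β u φ n ≤ ε + ε := by
    intro ε hε
    obtain ⟨T, hT, hnet⟩ := hcpt (1 + (2 * α) ^ α * Real.exp 1) ε hε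
    set P : (ℂ → ℂ) → ℕ → Prop := fun g n =>
      zygNorm β (fun z => wcomp u φ (normMonomial α n) z - g z) ≤ ε with hP
    have hfreq : ∀ᶠ n in atTop, ∀ g ∈ T, P g n → ∃ᶠ m in atTop, P g m := by
      rw [Finset.eventually_all]
      intro g _
      by_cases h : ∃ᶠ m in atTop, P g m
      · exact Eventually.of_forall fun _ _ => h
      · exact (not_frequently.1 h).mono fun n hn hn' => absurd hn' hn
    have hclose : ∀ g ∈ T, ∀ n, P g n → ∀ z ∈ unitDisk, (1 - ‖z‖ ^ 2) ^ β *
        ‖deriv (deriv (wcomp u φ (normMonomial α n))) z - deriv (deriv g) z‖ ≤ ε := by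
      intro g hg n hn z hz
      have hw := hb.1 _ (memBloch_normMonomial hα n)
      have hbd : WBdd β (deriv (deriv fun z => wcomp u φ (normMonomial α n) z - g z)) :=
        WBdd.mono (WBdd.sub hw.2 (hT g hg).2) fun w hw' => by
          rw [deriv_deriv_sub_of_differentiableOn hw.1 (hT g hg).1 hw']
      have h1 := hbd.le_wnorm hz
      rw [deriv_deriv_sub_of_differentiableOn hw.1 (hT g hg).1 hz] at h1
      simp only [hP, zygNorm] at hn
      refine h1.trans (le_trans ?_ hn)
      exact le_add_of_nonneg_left (add_nonneg (norm_nonneg _) (norm_nonneg _))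
    filter_upwards [hfreq] with n hn
    obtain ⟨g, hg, hgn⟩ :=
      hnet _ (memBloch_normMonomial hα n) (blochNorm_normMonomial_le hα n)
    have hgsmall : ∀ z ∈ unitDisk, (1 - ‖z‖ ^ 2) ^ β * ‖deriv (deriv g) z‖ ≤ ε := by
      intro z hz
      by_contra! hlt
      have ht := (tendsto_weighted_powImage (α := α) hu hφd hφm hz).const_mul
        ((1 - ‖z‖ ^ 2) ^ β)
      rw [mul_zero] at ht
      have hev := ht.eventually (gt_mem_nhds (sub_pos.2 hlt))
      obtain ⟨m, hm, hm'⟩ := ((hn g hg hgn).and_eventually hev).exists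
      have h1 := hclose g hg m hm z hz
      have h2 := weighted_norm_sub_le (γ := β) hz
        (deriv (deriv (wcomp u φ (normMonomial α m))) z)
        (deriv (deriv (wcomp u φ (normMonomial α m))) z - deriv (deriv g) z)
      rw [sub_sub_cancel] at h2
      have h3 : ‖deriv (deriv (wcomp u φ (normMonomial α m))) z‖
          = (m : ℝ) ^ (α - 1) * ‖powImage u φ m z‖ := by
        rw [deriv_deriv_wcomp_normMonomial, norm_mul, Complex.norm_real,
          Real.norm_of_nonneg (by positivity)]
      rw [h3] at h2
      linarith
    refine wnorm_le fun z hz => ?_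
    have h2 := weighted_norm_add_le (γ := β) hz
      (deriv (deriv (wcomp u φ (normMonomial α n))) z - deriv (deriv g) z) (deriv (deriv g) z)
    rw [sub_add_cancel] at h2
    linarith [hclose g hg n hgn z hz, hgsmall z hz]
  rw [tendsto_order]
  refine ⟨fun a ha => Eventually.of_forall fun n => ha.trans_le (wnorm_nonneg _ _), fun a ha => ?_⟩
  filter_upwards [key (a / 3) (by positivity)] with n hn
  linarith

lemma weighted_powImage_le (hα : 1 < α) (hb : BoundedBlochToZygmund α β u φ) (n : ℕ) {k : ℕ}
    (hk : 1 ≤ k) {z : ℂ} (hz : z ∈ unitDisk) :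
    (n : ℝ) ^ (α - 1) * ((1 - ‖z‖ ^ 2) ^ β * ‖powImage u φ (k * n) z‖)
      ≤ monomialImageNorm α β u φ (k * n) := by
  have h := WBdd.le_wnorm (hb.1 _ (memBloch_normMonomial hα (k * n))).2 hz
  rw [deriv_deriv_wcomp_normMonomial, norm_mul, Complex.norm_real,
    Real.norm_of_nonneg (by positivity), mul_left_comm] at h
  refine le_trans ?_ h
  refine mul_le_mul_of_nonneg_right ?_ (mul_nonneg (weight_nonneg β hz) (norm_nonneg _))
  refine Real.rpow_le_rpow (by positivity) ?_ (by linarith)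
  exact_mod_cast Nat.le_mul_of_pos_left n hk

end Coefficients

section PowerDecay

variable {u φ : ℂ → ℂ} {α β : ℝ}

lemma weighted_norm_le_of_norm_mul_le {w c x t y : ℝ} (hw : 0 ≤ w) (hc : 0 ≤ c)
    (h : t * x ≤ y) : c * t * (w * x) ≤ c * (w * y) := by
  calc c * t * (w * x) = c * (w * (t * x)) := by ring
    _ ≤ _ := by gcongr

lemma tendsto_coeffTwo (hu : DifferentiableOn ℂ u unitDisk)
    (hφd : DifferentiableOn ℂ φ unitDisk) (hφm : MapsTo φ unitDisk unitDisk) (hα : 1 < α)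
    (hb : BoundedBlochToZygmund α β u φ)
    (hW : Tendsto (monomialImageNorm α β u φ) atTop (nhds 0)) :
    Tendsto (fun n : ℕ => ((n : ℝ) + 1) ^ (α + 1) *
      wnorm β (fun z => coeffTwo u φ z * φ z ^ n)) atTop (nhds 0) := by
  have hD := wBdd_coeffTwo hu hφd hφm hα hb
  refine tendsto_rpow_mul_of_antitone (by linarith) (hD.antitone_wnorm_mul_pow hφm)
    (fun _ => wnorm_nonneg _ _) ?_
  have h3 : Tendsto (fun n : ℕ => 3 * n) atTop atTop := tendsto_id.const_mul_atTop' (by norm_num)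
  have h2 : Tendsto (fun n : ℕ => 2 * n) atTop atTop := tendsto_id.const_mul_atTop' (by norm_num)
  have hlim := ((hW.comp h3).add ((hW.comp h2).const_mul 2)).add hW
  simp only [mul_zero, add_zero] at hlim
  refine squeeze_zero' (Eventually.of_forall fun n => mul_nonneg (by positivity)
    (wnorm_nonneg _ _)) ?_ hlim
  filter_upwards [eventually_ge_atTop 1] with n hn
  have hn0 : (0 : ℝ) < n := by exact_mod_cast hn
  refine mul_wnorm_le (by positivity) fun z hz => ?_
  have ha := (norm_lt_one_of_mapsTo hφm hz).le
  have hw := weight_nonneg β hz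
  have e1 := sq_mul_powImage hu hφd hφm n hz
  have e2 := sq_mul_powImage hu hφd hφm (2 * n) hz
  have e3 := sq_mul_powImage hu hφd hφm (3 * n) hz
  have hid : 2 * (n : ℂ) ^ 2 * (coeffTwo u φ z * φ z ^ (3 * n)) = φ z ^ 2 *
      (powImage u φ (3 * n) z - 2 * φ z ^ n * powImage u φ (2 * n) z
        + φ z ^ (2 * n) * powImage u φ n z) := by
    push_cast at e2 e3
    rw [mul_comm 3 n, pow_mul] at e3 ⊢
    rw [mul_comm 2 n, pow_mul] at e2 ⊢
    linear_combination (-1 : ℂ) * e3 + 2 * φ z ^ n * e2 - (φ z ^ n) ^ 2 * e1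
  have hnorm : (n : ℝ) ^ 2 * ‖coeffTwo u φ z * φ z ^ (3 * n)‖ ≤
      ‖powImage u φ (3 * n) z‖ + 2 * ‖powImage u φ (2 * n) z‖ + ‖powImage u φ n z‖ := by
    have h := congrArg norm hid
    rw [norm_mul, norm_mul, norm_mul (φ z ^ 2), norm_pow (φ z), norm_pow (n : ℂ),
      Complex.norm_natCast, Complex.norm_ofNat] at h
    have hp1 : ‖φ z‖ ^ n ≤ 1 := pow_le_one₀ (norm_nonneg _) ha
    have hp2 : ‖φ z‖ ^ (2 * n) ≤ 1 := pow_le_one₀ (norm_nonneg _) ha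
    have hp : ‖φ z‖ ^ 2 ≤ 1 := pow_le_one₀ (norm_nonneg _) ha
    have ht : ‖powImage u φ (3 * n) z - 2 * φ z ^ n * powImage u φ (2 * n) z
        + φ z ^ (2 * n) * powImage u φ n z‖ ≤
        ‖powImage u φ (3 * n) z‖ + 2 * ‖powImage u φ (2 * n) z‖ + ‖powImage u φ n z‖ := by
      refine (norm_add_le _ _).trans (add_le_add ((norm_sub_le _ _).trans (add_le_add le_rfl ?_)) ?_)
      · rw [norm_mul, norm_mul, norm_pow, Complex.norm_ofNat]
        exact mul_le_mul_of_nonneg_right (by linarith) (norm_nonneg _)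
      · rw [norm_mul, norm_pow]
        exact mul_le_of_le_one_left (norm_nonneg _) hp2
    have h4 := mul_le_of_le_one_left (norm_nonneg (powImage u φ (3 * n) z
      - 2 * φ z ^ n * powImage u φ (2 * n) z + φ z ^ (2 * n) * powImage u φ n z)) hp
    have h5 : 0 ≤ (n : ℝ) ^ 2 * ‖coeffTwo u φ z * φ z ^ (3 * n)‖ := by positivity
    linarith
  have hfin := weighted_norm_le_of_norm_mul_le hw
    (Real.rpow_nonneg (Nat.cast_nonneg n) (α - 1)) hnorm
  rw [← Real.rpow_two, ← Real.rpow_add hn0] at hfin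
  have b1 := weighted_powImage_le hα hb n le_rfl hz
  have b2 := weighted_powImage_le hα hb n one_le_two hz
  have b3 := weighted_powImage_le hα hb n (k := 3) (by norm_num) hz
  rw [one_mul] at b1
  rw [show α - 1 + 2 = α + 1 by ring] at hfin
  simp only [Function.comp_apply]
  linarith

lemma tendsto_coeffOne (hu : DifferentiableOn ℂ u unitDisk)
    (hφd : DifferentiableOn ℂ φ unitDisk) (hφm : MapsTo φ unitDisk unitDisk) (hα : 1 < α)
    (hb : BoundedBlochToZygmund α β u φ)
    (hW : Tendsto (monomialImageNorm α β u φ) atTop (nhds 0)) :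
    Tendsto (fun n : ℕ => ((n : ℝ) + 1) ^ α *
      wnorm β (fun z => coeffOne u φ z * φ z ^ n)) atTop (nhds 0) := by
  have hB := wBdd_coeffOne hu hφd hφm hα hb
  have hD := wBdd_coeffTwo hu hφd hφm hα hb
  refine tendsto_rpow_mul_of_antitone (by linarith) (hB.antitone_wnorm_mul_pow hφm)
    (fun _ => wnorm_nonneg _ _) ?_
  have h2 : Tendsto (fun n : ℕ => 2 * n) atTop atTop := tendsto_id.const_mul_atTop' (by norm_num)
  have hlim := ((hW.comp h2).add hW).add
    ((tendsto_coeffTwo hu hφd hφm hα hb hW).const_mul 3)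
  simp only [mul_zero, add_zero] at hlim
  refine squeeze_zero' (Eventually.of_forall fun n => mul_nonneg (by positivity)
    (wnorm_nonneg _ _)) ?_ hlim
  filter_upwards [eventually_ge_atTop 1] with n hn
  have hn0 : (0 : ℝ) < n := by exact_mod_cast hn
  refine mul_wnorm_le (by positivity) fun z hz => ?_
  have ha := (norm_lt_one_of_mapsTo hφm hz).le
  have hw := weight_nonneg β hz
  have e1 := sq_mul_powImage hu hφd hφm n hz
  have e2 := sq_mul_powImage hu hφd hφm (2 * n) hz
  have hid : (n : ℂ) * (coeffOne u φ z * φ z ^ (2 * n + 1)) = φ z ^ 2 *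
      (powImage u φ (2 * n) z - φ z ^ n * powImage u φ n z)
        - (3 * n ^ 2 - n) * (φ z ^ n * (coeffTwo u φ z * φ z ^ n)) := by
    push_cast at e2
    rw [pow_succ]
    rw [mul_comm 2 n, pow_mul] at e2 ⊢
    linear_combination (-1 : ℂ) * e2 + φ z ^ n * e1
  have hnorm : (n : ℝ) * ‖coeffOne u φ z * φ z ^ (3 * n)‖ ≤
      ‖powImage u φ (2 * n) z‖ + ‖powImage u φ n z‖
        + 3 * (n ^ 2 * ‖coeffTwo u φ z * φ z ^ n‖) := by
    have hp1 : ‖φ z‖ ^ n ≤ 1 := pow_le_one₀ (norm_nonneg _) ha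
    have hp : ‖φ z‖ ^ 2 ≤ 1 := pow_le_one₀ (norm_nonneg _) ha
    have h0 : (n : ℝ) * ‖coeffOne u φ z * φ z ^ (3 * n)‖
        ≤ ‖(n : ℂ) * (coeffOne u φ z * φ z ^ (2 * n + 1))‖ := by
      simp only [norm_mul, norm_pow, Complex.norm_natCast]
      gcongr ?_ * (?_ * ?_)
      exact pow_le_pow_of_le_one (norm_nonneg _) ha (by omega)
    have hc : ‖(3 * n ^ 2 - n : ℂ)‖ ≤ 3 * (n : ℝ) ^ 2 := by
      have h1 : (n : ℝ) ≤ 3 * (n : ℝ) ^ 2 := by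
        have : (1 : ℝ) ≤ n := by exact_mod_cast hn
        nlinarith
      have : (3 * n ^ 2 - n : ℂ) = ((3 * (n : ℝ) ^ 2 - n : ℝ) : ℂ) := by push_cast; ring
      rw [this, Complex.norm_real, Real.norm_of_nonneg (by linarith)]
      linarith
    rw [hid] at h0
    refine h0.trans ((norm_sub_le _ _).trans (add_le_add ?_ ?_))
    · rw [norm_mul, norm_pow]
      refine (mul_le_of_le_one_left (norm_nonneg _) hp).trans
        ((norm_sub_le _ _).trans (add_le_add le_rfl ?_))
      rw [norm_mul, norm_pow]
      exact mul_le_of_le_one_left (norm_nonneg _) hp1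
    · rw [norm_mul, norm_mul (φ z ^ n), norm_pow (φ z), ← mul_assoc 3]
      exact mul_le_mul hc (mul_le_of_le_one_left (norm_nonneg _) hp1) (by positivity)
        (by positivity)
  have hfin := weighted_norm_le_of_norm_mul_le hw
    (Real.rpow_nonneg (Nat.cast_nonneg n) (α - 1)) hnorm
  have hpow1 : (n : ℝ) ^ (α - 1) * n = (n : ℝ) ^ α := by
    rw [← Real.rpow_add_one hn0.ne', sub_add_cancel]
  have hpow2 : (n : ℝ) ^ (α - 1) * (n : ℝ) ^ 2 = (n : ℝ) ^ (α + 1) := by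
    rw [← Real.rpow_two, ← Real.rpow_add hn0]; ring_nf
  have b1 := weighted_powImage_le hα hb n le_rfl hz
  have b2 := weighted_powImage_le hα hb n one_le_two hz
  have b3 : (n : ℝ) ^ (α + 1) * ((1 - ‖z‖ ^ 2) ^ β * ‖coeffTwo u φ z * φ z ^ n‖) ≤
      ((n : ℝ) + 1) ^ (α + 1) * wnorm β (fun z => coeffTwo u φ z * φ z ^ n) := by
    refine mul_le_mul (Real.rpow_le_rpow hn0.le (by linarith) (by linarith))
      ((hD.mul_pow hφm n).le_wnorm hz) (mul_nonneg hw (norm_nonneg _)) (by positivity)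
  rw [one_mul] at b1
  rw [hpow1] at hfin
  rw [← hpow2] at b3
  simp only [Function.comp_apply]
  linarith

lemma tendsto_deriv_deriv (hu : DifferentiableOn ℂ u unitDisk)
    (hφd : DifferentiableOn ℂ φ unitDisk) (hφm : MapsTo φ unitDisk unitDisk) (hα : 1 < α)
    (hb : BoundedBlochToZygmund α β u φ)
    (hW : Tendsto (monomialImageNorm α β u φ) atTop (nhds 0)) :
    Tendsto (fun n : ℕ => ((n : ℝ) + 1) ^ (α - 1) *
      wnorm β (fun z => deriv (deriv u) z * φ z ^ n)) atTop (nhds 0) := by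
  have hA := wBdd_deriv_deriv hu hφd hφm hα hb
  have hB := wBdd_coeffOne hu hφd hφm hα hb
  have hD := wBdd_coeffTwo hu hφd hφm hα hb
  refine tendsto_rpow_mul_of_antitone (by linarith) (hA.antitone_wnorm_mul_pow hφm)
    (fun _ => wnorm_nonneg _ _) ?_
  have hlim := (hW.add (tendsto_coeffOne hu hφd hφm hα hb hW)).add
    (tendsto_coeffTwo hu hφd hφm hα hb hW)
  simp only [add_zero] at hlim
  refine squeeze_zero' (Eventually.of_forall fun n => mul_nonneg (by positivity)
    (wnorm_nonneg _ _)) ?_ hlim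
  filter_upwards [eventually_ge_atTop 1] with n hn
  have hn0 : (0 : ℝ) < n := by exact_mod_cast hn
  refine mul_wnorm_le (by positivity) fun z hz => ?_
  have ha := (norm_lt_one_of_mapsTo hφm hz).le
  have hw := weight_nonneg β hz
  have e1 := sq_mul_powImage hu hφd hφm n hz
  have hid : deriv (deriv u) z * φ z ^ (n + 2) = φ z ^ 2 * powImage u φ n z
      - n * (φ z * (coeffOne u φ z * φ z ^ n)) - n * (n - 1) * (coeffTwo u φ z * φ z ^ n) := by
    rw [e1]
    ring
  have hnorm : 1 * ‖deriv (deriv u) z * φ z ^ (3 * n)‖ ≤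
      ‖powImage u φ n z‖ + n * ‖coeffOne u φ z * φ z ^ n‖
        + n ^ 2 * ‖coeffTwo u φ z * φ z ^ n‖ := by
    have hp : ‖φ z‖ ^ 2 ≤ 1 := pow_le_one₀ (norm_nonneg _) ha
    have h0 : ‖deriv (deriv u) z * φ z ^ (3 * n)‖ ≤ ‖deriv (deriv u) z * φ z ^ (n + 2)‖ := by
      simp only [norm_mul, norm_pow]
      gcongr ?_ * ?_
      exact pow_le_pow_of_le_one (norm_nonneg _) ha (by omega)
    have hc : ‖(n * (n - 1) : ℂ)‖ ≤ (n : ℝ) ^ 2 := by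
      have h1 : (1 : ℝ) ≤ n := by exact_mod_cast hn
      have : (n * (n - 1) : ℂ) = (((n : ℝ) * (n - 1) : ℝ) : ℂ) := by push_cast; ring
      rw [this, Complex.norm_real, Real.norm_of_nonneg (by nlinarith)]
      nlinarith
    rw [hid] at h0
    rw [one_mul]
    refine h0.trans ((norm_sub_le _ _).trans
      (add_le_add ((norm_sub_le _ _).trans (add_le_add ?_ ?_)) ?_))
    · rw [norm_mul, norm_pow]
      exact mul_le_of_le_one_left (norm_nonneg _) hp
    · rw [norm_mul, norm_mul (φ z), Complex.norm_natCast]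
      exact mul_le_mul_of_nonneg_left (mul_le_of_le_one_left (norm_nonneg _) ha) hn0.le
    · rw [norm_mul]
      exact mul_le_mul_of_nonneg_right hc (norm_nonneg _)
  have hfin := weighted_norm_le_of_norm_mul_le hw
    (Real.rpow_nonneg (Nat.cast_nonneg n) (α - 1)) hnorm
  have hpow1 : (n : ℝ) ^ (α - 1) * n = (n : ℝ) ^ α := by
    rw [← Real.rpow_add_one hn0.ne', sub_add_cancel]
  have hpow2 : (n : ℝ) ^ (α - 1) * (n : ℝ) ^ 2 = (n : ℝ) ^ (α + 1) := by
    rw [← Real.rpow_two, ← Real.rpow_add hn0]; ring_nf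
  have b1 := weighted_powImage_le hα hb n le_rfl hz
  have b2 : (n : ℝ) ^ α * ((1 - ‖z‖ ^ 2) ^ β * ‖coeffOne u φ z * φ z ^ n‖) ≤
      ((n : ℝ) + 1) ^ α * wnorm β (fun z => coeffOne u φ z * φ z ^ n) := by
    refine mul_le_mul (Real.rpow_le_rpow hn0.le (by linarith) (by linarith))
      ((hB.mul_pow hφm n).le_wnorm hz) (mul_nonneg hw (norm_nonneg _)) (by positivity)
  have b3 : (n : ℝ) ^ (α + 1) * ((1 - ‖z‖ ^ 2) ^ β * ‖coeffTwo u φ z * φ z ^ n‖) ≤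
      ((n : ℝ) + 1) ^ (α + 1) * wnorm β (fun z => coeffTwo u φ z * φ z ^ n) := by
    refine mul_le_mul (Real.rpow_le_rpow hn0.le (by linarith) (by linarith))
      ((hD.mul_pow hφm n).le_wnorm hz) (mul_nonneg hw (norm_nonneg _)) (by positivity)
  rw [one_mul] at b1
  rw [mul_one] at hfin
  rw [← hpow1] at b2
  rw [← hpow2] at b3
  linarith

end PowerDecay

section Growth

variable {α R : ℝ} {f : ℂ → ℂ}

lemma norm_deriv_le_of_norm_le (hf : DifferentiableOn ℂ f unitDisk) {w : ℂ} {d C : ℝ}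
    (hd : 0 < d) (hwd : ‖w‖ + d < 1) (hC : ∀ z : ℂ, ‖z‖ ≤ ‖w‖ + d → ‖f z‖ ≤ C) :
    ‖deriv f w‖ ≤ C / d := by
  have hnorm : ∀ z ∈ Metric.closedBall w d, ‖z‖ ≤ ‖w‖ + d := fun z hz => by
    have h1 : ‖z - w‖ ≤ d := by simpa [dist_eq_norm] using hz
    have h2 := norm_add_le w (z - w)
    rw [add_sub_cancel] at h2
    linarith
  refine Complex.norm_deriv_le_of_forall_mem_sphere_norm_le hd ?_ fun z hz =>
    hC z (hnorm z (Metric.sphere_subset_closedBall hz))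
  refine DifferentiableOn.diffContOnCl (hf.mono fun z hz => ?_)
  exact mem_unitDisk_iff.2 ((hnorm z (Metric.closure_ball_subset_closedBall hz)).trans_lt hwd)

lemma MemBloch.norm_deriv_le (hα : 0 < α) (hf : MemBloch α f) (hR : blochNorm α f ≤ R) {w : ℂ}
    (hw : ‖w‖ < 1) : ‖deriv f w‖ ≤ R * (1 - ‖w‖) ^ (-α) := by
  have hw' := mem_unitDisk_iff.2 hw
  have h1 : (1 - ‖w‖ ^ 2) ^ α * ‖deriv f w‖ ≤ R :=
    (WBdd.le_wnorm hf.2 hw').trans (le_trans (le_add_of_nonneg_left (norm_nonneg _)) hR)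
  have h2 : (1 - ‖w‖) ^ α ≤ (1 - ‖w‖ ^ 2) ^ α :=
    Real.rpow_le_rpow (by linarith) (by nlinarith [norm_nonneg w]) hα.le
  have h3 : 0 < (1 - ‖w‖) ^ α := Real.rpow_pos_of_pos (by linarith) _
  rw [Real.rpow_neg (by linarith), ← div_eq_mul_inv, le_div_iff₀ h3]
  nlinarith [norm_nonneg (deriv f w)]

lemma MemBloch.norm_le (hα : 1 < α) (hf : MemBloch α f) (hR : blochNorm α f ≤ R) {w : ℂ}
    (hw : ‖w‖ < 1) : ‖f w‖ ≤ (1 + (α - 1)⁻¹) * R * (1 - ‖w‖) ^ (1 - α) := by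
  have hα1 : 0 < α - 1 := by linarith
  have hR0 : 0 ≤ R := (blochNorm_nonneg α f).trans hR
  have hf0 : ‖f 0‖ ≤ R := le_trans (le_add_of_nonneg_right (wnorm_nonneg _ _)) hR
  have hlt : ∀ t ∈ Icc (0 : ℝ) 1, t * ‖w‖ < 1 := fun t ht =>
    (mul_le_of_le_one_left (norm_nonneg _) ht.2).trans_lt hw
  have hnorm : ∀ t ∈ Icc (0 : ℝ) 1, ‖(t : ℂ) * w‖ = t * ‖w‖ := fun t ht => by
    rw [norm_mul, Complex.norm_real, Real.norm_of_nonneg ht.1]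
  have hmem : ∀ t ∈ Icc (0 : ℝ) 1, (t : ℂ) * w ∈ unitDisk := fun t ht => by
    rw [mem_unitDisk_iff, hnorm t ht]; exact hlt t ht
  have hderiv : ∀ t ∈ Icc (0 : ℝ) 1,
      HasDerivAt (fun t : ℝ => f ((t : ℂ) * w)) (deriv f ((t : ℂ) * w) * w) t := fun t ht => by
    have h1 : HasDerivAt (fun s : ℂ => s * w) w (t : ℂ) := by
      simpa using (hasDerivAt_id (t : ℂ)).mul_const w
    exact (HasDerivAt.comp (t : ℂ)
      (hasDerivAt_of_differentiableOn hf.1 (hmem t ht)) h1).comp_ofReal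
  have hB : ∀ t ∈ Icc (0 : ℝ) 1,
      HasDerivAt (fun t : ℝ => R + R * (α - 1)⁻¹ * (1 - t * ‖w‖) ^ (1 - α))
        (R * (1 - t * ‖w‖) ^ (-α) * ‖w‖) t := fun t ht => by
    have h0 : 0 < 1 - t * ‖w‖ := by linarith [hlt t ht]
    have h1 : HasDerivAt (fun t : ℝ => 1 - t * ‖w‖) (-‖w‖) t := by
      simpa using ((hasDerivAt_id t).mul_const ‖w‖).const_sub 1
    have h2 := ((h1.rpow_const (p := 1 - α) (Or.inl h0.ne')).const_mul
      (R * (α - 1)⁻¹)).const_add R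
    refine h2.congr_deriv ?_
    rw [show 1 - α - 1 = -α by ring]
    field_simp
    ring
  have h := image_norm_le_of_norm_deriv_right_le_deriv_boundary'
    (f := fun t : ℝ => f ((t : ℂ) * w)) (a := 0) (b := 1)
    (fun t ht => (hderiv t ht).continuousAt.continuousWithinAt)
    (fun t ht => (hderiv t (Ico_subset_Icc_self ht)).hasDerivWithinAt)
    (B := fun t : ℝ => R + R * (α - 1)⁻¹ * (1 - t * ‖w‖) ^ (1 - α))
    (by
      simp only [ofReal_zero, zero_mul, sub_zero, Real.one_rpow, mul_one]
      exact hf0.trans (le_add_of_nonneg_right (by positivity)))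
    (fun t ht => (hB t ht).continuousAt.continuousWithinAt)
    (fun t ht => (hB t (Ico_subset_Icc_self ht)).hasDerivWithinAt)
    (fun t ht => by
      have ht' := Ico_subset_Icc_self ht
      have h1 := hf.norm_deriv_le (by linarith) hR (mem_unitDisk_iff.1 (hmem t ht'))
      rw [hnorm t ht'] at h1
      rw [norm_mul]
      exact mul_le_mul_of_nonneg_right h1 (norm_nonneg _))
    (right_mem_Icc.2 zero_le_one)
  simp only [ofReal_one, one_mul] at h
  have hone : 1 ≤ (1 - ‖w‖) ^ (1 - α) :=
    Real.one_le_rpow_of_pos_of_le_one_of_nonpos (by linarith) (by linarith [norm_nonneg w])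
      (by linarith)
  nlinarith

lemma MemBloch.norm_deriv_deriv_le (hα : 0 < α) (hf : MemBloch α f) (hR : blochNorm α f ≤ R)
    {w : ℂ} (hw : ‖w‖ < 1) :
    ‖deriv (deriv f) w‖ ≤ 2 ^ (α + 1) * R * (1 - ‖w‖) ^ (-(α + 1)) := by
  have hR0 : 0 ≤ R := (blochNorm_nonneg α f).trans hR
  set d : ℝ := (1 - ‖w‖) / 2 with hd
  have hd0 : 0 < d := by rw [hd]; linarith
  have h := norm_deriv_le_of_norm_le (differentiableOn_deriv hf.1) (w := w) (d := d)
    (C := R * d ^ (-α)) hd0 (by rw [hd]; linarith) fun z hz => by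
      have hz1 : ‖z‖ < 1 := by linarith
      refine (hf.norm_deriv_le hα hR hz1).trans (mul_le_mul_of_nonneg_left ?_ hR0)
      exact Real.rpow_le_rpow_of_nonpos hd0 (by linarith) (by linarith)
  refine h.trans (le_of_eq ?_)
  rw [mul_div_assoc, ← Real.rpow_sub_one hd0.ne', hd, Real.div_rpow (by linarith) (by norm_num),
    show -α - 1 = -(α + 1) by ring, Real.rpow_neg (by norm_num : (0 : ℝ) ≤ 2), div_inv_eq_mul]
  ring

end Growth

/-- If `‖h φ ^ n‖ = o((n + 1) ^ (-γ))`, then the weighted modulus of `h` is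
`o((1 - ‖φ z‖) ^ γ)` as `‖φ z‖ → 1`. -/
lemma exists_weighted_le_of_tendsto {β γ : ℝ} {h φ : ℂ → ℂ} (hγ : 0 ≤ γ)
    (hφm : MapsTo φ unitDisk unitDisk) (hh : WBdd β h)
    (hlim : Tendsto (fun n : ℕ => ((n : ℝ) + 1) ^ γ * wnorm β (fun z => h z * φ z ^ n))
      atTop (nhds 0)) {ε : ℝ} (hε : 0 < ε) :
    ∃ s < 1, ∀ z ∈ unitDisk, s < ‖φ z‖ →
      (1 - ‖z‖ ^ 2) ^ β * ‖h z‖ * (1 - ‖φ z‖) ^ (-γ) ≤ ε := by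
  obtain ⟨N, hN⟩ := eventually_atTop.1
    (hlim.eventually (gt_mem_nhds (show (0 : ℝ) < ε / 4 by positivity)))
  refine ⟨1 - 1 / ((N : ℝ) + 2), by linarith [show 0 < 1 / ((N : ℝ) + 2) by positivity],
    fun z hz hs => ?_⟩
  set x : ℝ := ‖φ z‖ with hx
  have hx1 : 0 < 1 - x := by linarith [norm_lt_one_of_mapsTo hφm hz]
  have hN2 : (N : ℝ) + 2 ≤ 1 / (1 - x) := by
    rw [le_div_iff₀ hx1]
    have h1 : 1 - x < 1 / ((N : ℝ) + 2) := by linarith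
    rw [lt_div_iff₀ (by positivity)] at h1
    linarith
  set n : ℕ := ⌊1 / (1 - x)⌋₊ with hn
  have hn1 : (n : ℝ) ≤ 1 / (1 - x) := Nat.floor_le (by positivity)
  have hn2 : 1 / (1 - x) < (n : ℝ) + 1 := Nat.lt_floor_add_one _
  have hnN : N + 2 ≤ n := by
    rw [hn]
    exact Nat.le_floor (by push_cast; exact hN2)
  have hpow : 1 / 4 ≤ x ^ n := by
    have h2n : (2 : ℝ) ≤ n := by exact_mod_cast (by omega : 2 ≤ n)
    have hnx : (n : ℝ) * (1 - x) ≤ 1 := by rwa [le_div_iff₀ hx1] at hn1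
    have hxh : 1 / 2 ≤ x := by nlinarith
    have hx0 : 0 ≤ x := norm_nonneg _
    obtain ⟨m, hm⟩ : ∃ m, n = 2 * m ∨ n = 2 * m + 1 := ⟨n / 2, by omega⟩
    have hber := one_add_mul_le_pow (a := x - 1) (by linarith) m
    rw [add_sub_cancel] at hber
    rcases hm with hm | hm
    · have hm' : (n : ℝ) = 2 * m := by exact_mod_cast hm
      have h3 : 1 / 2 ≤ x ^ m := by nlinarith
      rw [hm, two_mul, pow_add]
      nlinarith
    · have hm' : (n : ℝ) = 2 * m + 1 := by exact_mod_cast hm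
      have h3 : (1 - (m : ℝ) * (1 - x)) ≤ x ^ m := by linarith
      have h4 : 1 / 2 + (1 - x) / 2 ≤ x ^ m := by nlinarith
      have h5 : (1 / 2 + (1 - x) / 2) ^ 2 ≤ (x ^ m) ^ 2 :=
        pow_le_pow_left₀ (by linarith) h4 2
      have h6 : (1 / 2 + (1 - x) / 2) ^ 2 * x ≤ (x ^ m) ^ 2 * x :=
        mul_le_mul_of_nonneg_right h5 hx0
      rw [hm, pow_succ, mul_comm 2 m, pow_mul]
      refine le_trans ?_ h6
      have h7 : x ≤ 1 := by linarith
      nlinarith [mul_nonneg hx1.le hx1.le, mul_nonneg (mul_nonneg hx1.le hx1.le) hx0]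
  have hrpow : (1 - x) ^ (-γ) ≤ ((n : ℝ) + 1) ^ γ := by
    rw [Real.rpow_neg hx1.le, ← Real.inv_rpow hx1.le, ← one_div]
    exact Real.rpow_le_rpow (by positivity) hn2.le hγ
  have hle := (hh.mul_pow hφm n).le_wnorm hz
  rw [norm_mul, norm_pow, ← hx] at hle
  have hsmall := hN n (by omega)
  have hv : 0 ≤ (1 - ‖z‖ ^ 2) ^ β * ‖h z‖ := mul_nonneg (weight_nonneg β hz) (norm_nonneg _)
  calc (1 - ‖z‖ ^ 2) ^ β * ‖h z‖ * (1 - x) ^ (-γ)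
      ≤ (1 - ‖z‖ ^ 2) ^ β * ‖h z‖ * ((n : ℝ) + 1) ^ γ := by gcongr
    _ ≤ (4 * ((1 - ‖z‖ ^ 2) ^ β * (‖h z‖ * x ^ n))) * ((n : ℝ) + 1) ^ γ := by
        refine mul_le_mul_of_nonneg_right ?_ (by positivity)
        nlinarith
    _ ≤ (4 * wnorm β (fun z => h z * φ z ^ n)) * ((n : ℝ) + 1) ^ γ := by gcongr
    _ ≤ ε := by linarith

/-- Bloch balls are totally bounded for uniform convergence of values on compact disks. -/
lemma exists_finite_net_values {α : ℝ} (hα : 1 < α) (r : ℝ) {s δ : ℝ} (hs : s < 1) (hδ : 0 < δ) :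
    ∃ F : Finset (ℂ → ℂ), (∀ g ∈ F, MemBloch α g ∧ blochNorm α g ≤ r) ∧
      ∀ f, MemBloch α f → blochNorm α f ≤ r → ∃ g ∈ F, ∀ w : ℂ, ‖w‖ ≤ s → ‖f w - g w‖ ≤ δ := by
  classical
  set S : Set (ℂ → ℂ) := {f | MemBloch α f ∧ blochNorm α f ≤ r} with hS
  set K : ℝ := |r| * (1 - s) ^ (-α) + 1 with hK
  set M : ℝ := (1 + (α - 1)⁻¹) * |r| * (1 - s) ^ (1 - α) with hM
  have hs1 : 0 < 1 - s := by linarith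
  have hα1 : 0 < α - 1 := by linarith
  have hK0 : 0 < K := by positivity
  have hlip : ∀ f ∈ S, ∀ z : ℂ, ‖z‖ ≤ s → ∀ w : ℂ, ‖w‖ ≤ s → ‖f z - f w‖ ≤ K * ‖z - w‖ := by
    rintro f ⟨hf, hfr⟩ z hz w hw
    refine Convex.norm_image_sub_le_of_norm_deriv_le (s := Metric.closedBall (0 : ℂ) s)
      (fun x hx => ?_) (fun x hx => ?_) (convex_closedBall _ _) (by simpa using hw)
      (by simpa using hz)
    · have hx : ‖x‖ ≤ s := by simpa using hx
      exact (hasDerivAt_of_differentiableOn hf.1 (mem_unitDisk_iff.2 (by linarith))).differentiableAt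
    · have hx : ‖x‖ ≤ s := by simpa using hx
      have h1 := hf.norm_deriv_le (by linarith) (hfr.trans (le_abs_self r))
        (w := x) (by linarith)
      have h2 : (1 - ‖x‖) ^ (-α) ≤ (1 - s) ^ (-α) :=
        Real.rpow_le_rpow_of_nonpos hs1 (by linarith) (by linarith)
      have h3 := mul_le_mul_of_nonneg_left h2 (abs_nonneg r)
      linarith
  have hbound : ∀ f ∈ S, ∀ z : ℂ, ‖z‖ ≤ s → ‖f z‖ ≤ M := by
    rintro f ⟨hf, hfr⟩ z hz
    refine (hf.norm_le hα (hfr.trans (le_abs_self r)) (by linarith)).trans ?_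
    exact mul_le_mul_of_nonneg_left
      (Real.rpow_le_rpow_of_nonpos hs1 (by linarith) (by linarith)) (by positivity)
  obtain ⟨t, hts, htfin, htcover⟩ := (isCompact_closedBall (0 : ℂ) s).finite_cover_balls
    (show 0 < δ / (3 * K) by positivity)
  have : Fintype t := htfin.fintype
  let ev : (ℂ → ℂ) → (t → ℂ) := fun f p => f p
  have htot : TotallyBounded (ev '' S) := by
    refine (isCompact_closedBall (0 : t → ℂ) (max M 0)).totallyBounded.subset ?_
    rintro _ ⟨f, hf, rfl⟩
    rw [mem_closedBall_zero_iff, pi_norm_le_iff_of_nonneg (le_max_right _ _)]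
    exact fun p => (hbound f hf p (by simpa using hts p.2)).trans (le_max_left _ _)
  obtain ⟨T, hTS, hTfin, hTcover⟩ :=
    Metric.finite_approx_of_totallyBounded htot (δ / 3) (by positivity)
  lift T to Finset (t → ℂ) using hTfin
  obtain ⟨F, hFS, rfl⟩ := Finset.subset_set_image_iff.1 hTS
  refine ⟨F, fun g hg => hFS hg, fun f hf hfr => ?_⟩
  obtain ⟨y, hy, hfy⟩ := mem_iUnion₂.1 (hTcover ⟨f, ⟨hf, hfr⟩, rfl⟩)
  obtain ⟨g, hg, rfl⟩ := Finset.mem_image.1 (Finset.mem_coe.1 hy)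
  refine ⟨g, hg, fun w hw => ?_⟩
  obtain ⟨p, hp, hwp⟩ := mem_iUnion₂.1 (htcover (by simpa using hw : w ∈ Metric.closedBall 0 s))
  have hps : ‖p‖ ≤ s := by simpa using hts hp
  have h1 : ‖f p - g p‖ ≤ δ / 3 := by
    rw [← dist_eq_norm]
    exact (dist_le_pi_dist (ev f) (ev g) ⟨p, hp⟩).trans (Metric.mem_ball.1 hfy).le
  have hKw : K * ‖w - p‖ ≤ δ / 3 := by
    have h2 : ‖w - p‖ ≤ δ / (3 * K) := by
      rw [← dist_eq_norm]
      exact (Metric.mem_ball.1 hwp).le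
    calc K * ‖w - p‖ ≤ K * (δ / (3 * K)) := by gcongr
      _ = δ / 3 := by field_simp
  have h3 := (hlip f ⟨hf, hfr⟩ w hw p hps).trans hKw
  have h4 := (hlip g (hFS hg) w hw p hps).trans hKw
  rw [norm_sub_rev] at h4
  calc ‖f w - g w‖ = ‖(f w - f p) + (f p - g p) + (g p - g w)‖ := by ring_nf
    _ ≤ δ / 3 + δ / 3 + δ / 3 := norm_add₃_le.trans (add_le_add (add_le_add h3 h1) h4)
    _ = δ := by ring

/-- Bloch balls are totally bounded for uniform convergence of the functions and their first two
derivatives on compact disks. -/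
lemma exists_finite_net_derivs {α : ℝ} (hα : 1 < α) (r : ℝ) {s δ : ℝ} (hs : s < 1) (hδ : 0 < δ) :
    ∃ F : Finset (ℂ → ℂ), (∀ g ∈ F, MemBloch α g ∧ blochNorm α g ≤ r) ∧
      ∀ f, MemBloch α f → blochNorm α f ≤ r → ∃ g ∈ F, ∀ w : ℂ, ‖w‖ ≤ s →
        ‖f w - g w‖ ≤ δ ∧ ‖deriv (fun z => f z - g z) w‖ ≤ δ ∧
          ‖deriv (deriv fun z => f z - g z) w‖ ≤ δ := by
  set d : ℝ := min ((1 - s) / 3) 1 with hd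
  have hd0 : 0 < d := lt_min (by linarith) one_pos
  have hd1 : d ≤ 1 := min_le_right _ _
  have hds : d ≤ (1 - s) / 3 := min_le_left _ _
  obtain ⟨F, hF, hnet⟩ := exists_finite_net_values hα r (s := s + 2 * d) (δ := δ * d * d)
    (by linarith) (by positivity)
  refine ⟨F, hF, fun f hf hfr => ?_⟩
  obtain ⟨g, hg, hfg⟩ := hnet f hf hfr
  have hdiff : DifferentiableOn ℂ (fun z => f z - g z) unitDisk := hf.1.sub (hF g hg).1.1
  have hder : ∀ w : ℂ, ‖w‖ ≤ s + d → ‖deriv (fun z => f z - g z) w‖ ≤ δ * d := fun w hw =>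
    (norm_deriv_le_of_norm_le hdiff hd0 (by linarith) fun z hz => hfg z (by linarith)).trans
      (by rw [mul_div_cancel_right₀ _ hd0.ne'])
  refine ⟨g, hg, fun w hw => ⟨(hfg w (by linarith)).trans ?_,
    (hder w (by linarith)).trans (by nlinarith), ?_⟩⟩
  · rw [mul_assoc]
    exact mul_le_of_le_one_right hδ.le (by nlinarith)
  · exact (norm_deriv_le_of_norm_le (differentiableOn_deriv hdiff) hd0 (by linarith)
      fun z hz => hder z (by linarith)).trans (by rw [mul_div_cancel_right₀ _ hd0.ne'])

section Compactness

variable {u φ : ℂ → ℂ} {α β : ℝ}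

lemma weighted_deriv_deriv_wcomp_le (hu : DifferentiableOn ℂ u unitDisk)
    (hφd : DifferentiableOn ℂ φ unitDisk) (hφm : MapsTo φ unitDisk unitDisk) {h : ℂ → ℂ}
    (hh : DifferentiableOn ℂ h unitDisk) {z : ℂ} (hz : z ∈ unitDisk) {a b c : ℝ}
    (ha : ‖h (φ z)‖ ≤ a) (hb : ‖deriv h (φ z)‖ ≤ b) (hc : ‖deriv (deriv h) (φ z)‖ ≤ c) :
    (1 - ‖z‖ ^ 2) ^ β * ‖deriv (deriv (wcomp u φ h)) z‖ ≤
      (1 - ‖z‖ ^ 2) ^ β * ‖deriv (deriv u) z‖ * a + (1 - ‖z‖ ^ 2) ^ β * ‖coeffOne u φ z‖ * b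
        + (1 - ‖z‖ ^ 2) ^ β * ‖coeffTwo u φ z‖ * c := by
  have hw := weight_nonneg β hz
  rw [deriv_deriv_wcomp hu hφd hφm hh hz]
  have key : ‖deriv (deriv u) z * h (φ z) + coeffOne u φ z * deriv h (φ z)
      + coeffTwo u φ z * deriv (deriv h) (φ z)‖ ≤
      ‖deriv (deriv u) z‖ * a + ‖coeffOne u φ z‖ * b + ‖coeffTwo u φ z‖ * c := by
    refine norm_add₃_le.trans ?_
    rw [norm_mul, norm_mul, norm_mul]
    gcongr
  have := mul_le_mul_of_nonneg_left key hw
  simp only [coeffOne, coeffTwo] at this ⊢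
  linarith

lemma wnorm_deriv_deriv_wcomp_le (hu : DifferentiableOn ℂ u unitDisk)
    (hφd : DifferentiableOn ℂ φ unitDisk) (hφm : MapsTo φ unitDisk unitDisk) (hα : 1 < α)
    (hA : WBdd β (deriv (deriv u))) (hB : WBdd β (coeffOne u φ)) (hD : WBdd β (coeffTwo u φ))
    {h : ℂ → ℂ} (hh : MemBloch α h) {R s δ η : ℝ} (hR : blochNorm α h ≤ R) (hδ : 0 ≤ δ)
    (hη : 0 ≤ η)
    (hsmall : ∀ w : ℂ, ‖w‖ ≤ s →
      ‖h w‖ ≤ δ ∧ ‖deriv h w‖ ≤ δ ∧ ‖deriv (deriv h) w‖ ≤ δ)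
    (hAs : ∀ z ∈ unitDisk, s < ‖φ z‖ →
      (1 - ‖z‖ ^ 2) ^ β * ‖deriv (deriv u) z‖ * (1 - ‖φ z‖) ^ (-(α - 1)) ≤ η)
    (hBs : ∀ z ∈ unitDisk, s < ‖φ z‖ →
      (1 - ‖z‖ ^ 2) ^ β * ‖coeffOne u φ z‖ * (1 - ‖φ z‖) ^ (-α) ≤ η)
    (hDs : ∀ z ∈ unitDisk, s < ‖φ z‖ →
      (1 - ‖z‖ ^ 2) ^ β * ‖coeffTwo u φ z‖ * (1 - ‖φ z‖) ^ (-(α + 1)) ≤ η) :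
    wnorm β (deriv (deriv (wcomp u φ h))) ≤
      (wnorm β (deriv (deriv u)) + wnorm β (coeffOne u φ) + wnorm β (coeffTwo u φ)) * δ
        + ((1 + (α - 1)⁻¹) + 1 + 2 ^ (α + 1)) * R * η := by
  have hα1 : 0 < α - 1 := by linarith
  have hR0 : 0 ≤ R := (blochNorm_nonneg α h).trans hR
  refine wnorm_le fun z hz => ?_
  rcases le_or_gt ‖φ z‖ s with hzs | hzs
  · obtain ⟨h0, h1, h2⟩ := hsmall _ hzs
    refine (weighted_deriv_deriv_wcomp_le hu hφd hφm hh.1 hz h0 h1 h2).trans ?_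
    refine le_trans ?_ (le_add_of_nonneg_right (by positivity))
    rw [← add_mul, ← add_mul]
    exact mul_le_mul_of_nonneg_right
      (add_le_add (add_le_add (hA.le_wnorm hz) (hB.le_wnorm hz)) (hD.le_wnorm hz)) hδ
  · have hφ1 := norm_lt_one_of_mapsTo hφm hz
    refine (weighted_deriv_deriv_wcomp_le hu hφd hφm hh.1 hz (hh.norm_le hα hR hφ1)
      (hh.norm_deriv_le (by linarith) hR hφ1)
      (hh.norm_deriv_deriv_le (by linarith) hR hφ1)).trans ?_
    have ha := mul_le_mul_of_nonneg_left (hAs z hz hzs)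
      (show 0 ≤ (1 + (α - 1)⁻¹) * R by positivity)
    have hb := mul_le_mul_of_nonneg_left (hBs z hz hzs) hR0
    have hc := mul_le_mul_of_nonneg_left (hDs z hz hzs)
      (show 0 ≤ 2 ^ (α + 1) * R by positivity)
    rw [neg_sub] at ha
    have hM : 0 ≤ (wnorm β (deriv (deriv u)) + wnorm β (coeffOne u φ)
        + wnorm β (coeffTwo u φ)) * δ :=
      mul_nonneg (add_nonneg (add_nonneg (wnorm_nonneg _ _) (wnorm_nonneg _ _))
        (wnorm_nonneg _ _)) hδ
    linarith

lemma compactBlochToZygmund_of_tendsto (hu : DifferentiableOn ℂ u unitDisk)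
    (hφd : DifferentiableOn ℂ φ unitDisk) (hφm : MapsTo φ unitDisk unitDisk) (hα : 1 < α)
    (hb : BoundedBlochToZygmund α β u φ)
    (hBlim : Tendsto (fun n : ℕ => ((n : ℝ) + 1) ^ α *
      wnorm β (fun z => coeffOne u φ z * φ z ^ n)) atTop (nhds 0))
    (hDlim : Tendsto (fun n : ℕ => ((n : ℝ) + 1) ^ (α + 1) *
      wnorm β (fun z => coeffTwo u φ z * φ z ^ n)) atTop (nhds 0))
    (hAlim : Tendsto (fun n : ℕ => ((n : ℝ) + 1) ^ (α - 1) *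
      wnorm β (fun z => deriv (deriv u) z * φ z ^ n)) atTop (nhds 0)) :
    CompactBlochToZygmund α β u φ := by
  classical
  refine ⟨hb, fun r ε hε => ?_⟩
  have hα1 : 0 < α - 1 := by linarith
  have hA := wBdd_deriv_deriv hu hφd hφm hα hb
  have hB := wBdd_coeffOne hu hφd hφm hα hb
  have hD := wBdd_coeffTwo hu hφd hφm hα hb
  set C : ℝ := ((1 + (α - 1)⁻¹) + 1 + 2 ^ (α + 1)) * (2 * |r|) with hC
  have hC0 : 0 ≤ C := by positivity
  set η : ℝ := ε / (2 * (C + 1)) with hη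
  have hη0 : 0 < η := by positivity
  obtain ⟨sA, hsA, hAs⟩ := exists_weighted_le_of_tendsto hα1.le hφm hA hAlim hη0
  obtain ⟨sB, hsB, hBs⟩ := exists_weighted_le_of_tendsto (by linarith) hφm hB hBlim hη0
  obtain ⟨sD, hsD, hDs⟩ := exists_weighted_le_of_tendsto (by linarith) hφm hD hDlim hη0
  set s : ℝ := max (max sA sB) (max sD ‖φ 0‖) with hs
  have hs1 : s < 1 := max_lt (max_lt hsA hsB)
    (max_lt hsD (norm_lt_one_of_mapsTo hφm zero_mem_unitDisk))
  have hsA' : sA ≤ s := (le_max_left _ _).trans (le_max_left _ _)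
  have hsB' : sB ≤ s := (le_max_right _ _).trans (le_max_left _ _)
  have hsD' : sD ≤ s := (le_max_left _ _).trans (le_max_right _ _)
  have hs0 : ‖φ 0‖ ≤ s := (le_max_right _ _).trans (le_max_right _ _)
  set M : ℝ := wnorm β (deriv (deriv u)) + wnorm β (coeffOne u φ) + wnorm β (coeffTwo u φ) with hM
  have hM0 : 0 ≤ M :=
    add_nonneg (add_nonneg (wnorm_nonneg _ _) (wnorm_nonneg _ _)) (wnorm_nonneg _ _)
  set L : ℝ := ‖u 0‖ + (‖deriv u 0‖ + ‖u 0‖ * ‖deriv φ 0‖) with hL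
  have hL0 : 0 ≤ L := by positivity
  set δ : ℝ := ε / (2 * (L + M + 1)) with hδ
  have hδ0 : 0 < δ := by positivity
  obtain ⟨F, hF, hnet⟩ := exists_finite_net_derivs hα r hs1 hδ0
  refine ⟨F.image (wcomp u φ), fun k hk => ?_, fun f hf hfr => ?_⟩
  · obtain ⟨g, hg, rfl⟩ := Finset.mem_image.1 hk
    exact hb.1 g (hF g hg).1
  obtain ⟨g, hg, hfg⟩ := hnet f hf hfr
  refine ⟨wcomp u φ g, Finset.mem_image_of_mem _ hg, ?_⟩
  have hh : MemBloch α (fun z => f z - g z) := hf.sub (hF g hg).1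
  have hhr : blochNorm α (fun z => f z - g z) ≤ 2 * |r| := by
    linarith [hf.blochNorm_sub_le (hF g hg).1, (hF g hg).2, le_abs_self r]
  have heq : (fun z => wcomp u φ f z - wcomp u φ g z) = wcomp u φ (fun z => f z - g z) := by
    funext z
    simp only [wcomp]
    ring
  rw [heq]
  set h : ℂ → ℂ := fun z => f z - g z
  have hw := wnorm_deriv_deriv_wcomp_le hu hφd hφm hα hA hB hD hh hhr hδ0.le hη0.le hfg
    (fun z hz hzs => hAs z hz (hsA'.trans_lt hzs)) (fun z hz hzs => hBs z hz (hsB'.trans_lt hzs))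
    (fun z hz hzs => hDs z hz (hsD'.trans_lt hzs))
  obtain ⟨h0, h1, -⟩ := hfg (φ 0) hs0
  have hv0 : ‖wcomp u φ h 0‖ ≤ ‖u 0‖ * δ := by
    rw [wcomp, norm_mul]
    exact mul_le_mul_of_nonneg_left h0 (norm_nonneg _)
  have hv1 : ‖deriv (wcomp u φ h) 0‖ ≤ (‖deriv u 0‖ + ‖u 0‖ * ‖deriv φ 0‖) * δ := by
    rw [deriv_wcomp hu hφd hφm hh.1 zero_mem_unitDisk]
    refine (norm_add_le _ _).trans ?_
    rw [norm_mul, norm_mul, norm_mul, add_mul]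
    refine add_le_add (mul_le_mul_of_nonneg_left h0 (norm_nonneg _)) ?_
    rw [mul_assoc, mul_comm ‖deriv φ 0‖ δ]
    exact mul_le_mul_of_nonneg_left (mul_le_mul_of_nonneg_right h1 (norm_nonneg _)) (norm_nonneg _)
  have hCη : C * η ≤ ε / 2 := by
    rw [hη, mul_div_assoc', div_le_div_iff₀ (by positivity) (by norm_num)]
    nlinarith
  have hLδ : (L + M) * δ ≤ ε / 2 := by
    rw [hδ, mul_div_assoc', div_le_div_iff₀ (by positivity) (by norm_num)]
    nlinarith
  unfold zygNorm
  linarith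

end Compactness

/-- **Corollary 4.6 (iii)**. For `α > 1`, `uC_φ : B^α → Z_β` is compact iff it is bounded,
`(n+1)^α ‖(2u'φ'+uφ'')φ^n‖_ν_β → 0`, `(n+1)^(α+1) ‖u(φ')²φ^n‖_ν_β → 0` and
`(n+1)^(α-1) ‖u''φ^n‖_ν_β → 0`. -/
theorem weighted_comp_compact_Bloch_to_Zygmund_iff_of_one_lt
    (α β : ℝ) (hα : 1 < α) (hβ : 0 < β)
    (u φ : ℂ → ℂ) (hu : DifferentiableOn ℂ u unitDisk)
    (hφd : DifferentiableOn ℂ φ unitDisk) (hφm : Set.MapsTo φ unitDisk unitDisk) :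
    CompactBlochToZygmund α β u φ ↔
      BoundedBlochToZygmund α β u φ ∧
      Filter.Tendsto (fun n : ℕ => ((n : ℝ) + 1) ^ α * wnorm β (fun z => (2 * deriv u z * deriv φ z + u z * deriv (deriv φ) z) * φ z ^ n))
        Filter.atTop (nhds 0) ∧
      Filter.Tendsto (fun n : ℕ => ((n : ℝ) + 1) ^ (α + 1) * wnorm β (fun z => u z * deriv φ z ^ 2 * φ z ^ n))
        Filter.atTop (nhds 0) ∧
      Filter.Tendsto (fun n : ℕ => ((n : ℝ) + 1) ^ (α - 1) * wnorm β (fun z => deriv (deriv u) z * φ z ^ n))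
        Filter.atTop (nhds 0) := by
  refine ⟨fun hc => ?_, fun ⟨hb, hB, hD, hA⟩ =>
    compactBlochToZygmund_of_tendsto hu hφd hφm hα hb hB hD hA⟩
  have hW := tendsto_monomialImageNorm hu hφd hφm hα hc
  exact ⟨hc.1, tendsto_coeffOne hu hφd hφm hα hc.1 hW, tendsto_coeffTwo hu hφd hφm hα hc.1 hW,
    tendsto_deriv_deriv hu hφd hφm hα hc.1 hW⟩

end
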